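/- Let U = {(α,β) ∈ ℝ² : 0 < β ≤ α ≤ 1}, let G(α,β) = (β/α, (β−1)/α + ⌊1/α⌋), and let Ω_∞ = {(α,β) : G^n(α,β) lies in the interior of U for all n ≥ 0}. For (α,β) ∈ Ω_∞ set k_i = ⌊1/α_{i−1}⌋, where (α_{i−1},β_{i−1}) = G^{i−1}(α,β); this sequence satisfies condition (★), and X_{α,β} denotes the associated subshift. Then the set of (α,β) ∈ Ω_∞ such that for every ξ ∈ (0,1) the number e^{2πiξ} is not a continuous eigenvalue of (X_{α,β},σ) contains a dense G_δ subset of Ω_∞ (dense and a countable intersection of open sets in the subspace topology of Ω_∞ ⊆ ℝ²). -/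

import Mathlib

open Filter Topology MeasureTheory

/-- The substitution `χ_k` on the alphabet `{1,2,3}`, coded as `Fin 3 = {0,1,2}`
(letter 1 ↦ 0, letter 2 ↦ 1, letter 3 ↦ 2):
`χ_k(1) = 2`, `χ_k(2) = 3 1^k`, `χ_k(3) = 3 1^(k-1)`. -/
def chiSub (k : ℕ) : Fin 3 → List (Fin 3) :=
  ![[1], 2 :: List.replicate k 0, 2 :: List.replicate (k - 1) 0]

/-- Extension of `χ_k` to finite words by concatenation. -/
def applyChi (k : ℕ) (w : List (Fin 3)) : List (Fin 3) := w.flatMap (chiSub k)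

/-- `compApply k n w = χ_{k 1} ∘ χ_{k 2} ∘ ⋯ ∘ χ_{k n} (w)`. -/
def compApply (k : ℕ → ℕ) : ℕ → List (Fin 3) → List (Fin 3)
  | 0, w => w
  | n + 1, w => compApply k n (applyChi (k (n + 1)) w)

/-- Condition (★): k_{2i} > 1` for infinitely many `i` and `k_{2i-1} > 1`
for infinitely many `i`. -/
def StarCond (k : ℕ → ℕ) : Prop :=
  (∀ N, ∃ i ≥ N, 1 < k (2 * i)) ∧ (∀ N, ∃ i ≥ N, 1 < k (2 * i - 1))

/-- `w` is a prefix of the infinite sequence `x`. -/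
def IsPrefixSeq (w : List (Fin 3)) (x : ℕ → Fin 3) : Prop :=
  w = List.ofFn fun i : Fin w.length => x i

/-- The left shift `σ`. -/
def shift (x : ℕ → Fin 3) : ℕ → Fin 3 := fun i => x (i + 1)

/-- The closure of the `σ`-orbit of `ρ`: the subshift `X`. -/
def orbitClosure (ρ : ℕ → Fin 3) : Set (ℕ → Fin 3) :=
  closure {y | ∃ n : ℕ, y = fun i => ρ (i + n)}

/-- The matrix `A_k` with real entries, rows `(0,k,k-1)`, `(1,0,0)`, `(0,1,1)`. -/
noncomputable def Amat (k : ℕ) : Matrix (Fin 3) (Fin 3) ℝ :=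
  !![0, (k : ℝ), (k : ℝ) - 1; 1, 0, 0; 0, 1, 1]

/-- `Aprod k n = A_{k_1} A_{k_2} ⋯ A_{k_n}`. -/
noncomputable def Aprod (k : ℕ → ℕ) (n : ℕ) : Matrix (Fin 3) (Fin 3) ℝ :=
  ((List.range n).map fun i => Amat (k (i + 1))).prod

/-- `(ξ,ξ,ξ)` belongs to the stable space `W^s(0) mod 1`: for some integer vector `z`,
the row vectors `((ξ,ξ,ξ) − z) · A_{k_1} ⋯ A_{k_n}` tend to `0`. -/
def InStableMod1 (k : ℕ → ℕ) (ξ : ℝ) : Prop :=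
  ∃ z : Fin 3 → ℤ,
    Tendsto (fun n => Matrix.vecMul (fun i => ξ - (z i : ℝ)) (Aprod k n)) atTop (nhds 0)

/-- `c` is a continuous eigenvalue of the subshift `X`: there is a continuous function
`f` on `X`, not identically zero on `X`, with `f ∘ σ = c·f` on `X`. -/
def IsCtsEigenvalue (X : Set (ℕ → Fin 3)) (c : ℂ) : Prop :=
  ∃ f : (ℕ → Fin 3) → ℂ, ContinuousOn f X ∧ (∃ x ∈ X, f x ≠ 0) ∧
    ∀ x ∈ X, f (shift x) = c * f x

/-- The renormalization map `G(α,β) = (β/α, (β−1)/α + ⌊1/α⌋)`. -/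
noncomputable def Gmap (p : ℝ × ℝ) : ℝ × ℝ :=
  (p.2 / p.1, (p.2 - 1) / p.1 + (⌊1 / p.1⌋ : ℝ))

/-- The parameter set `U = {(α,β) : 0 < β ≤ α ≤ 1}`. -/
def Uset : Set (ℝ × ℝ) := {p | 0 < p.2 ∧ p.2 ≤ p.1 ∧ p.1 ≤ 1}

/-- `Ω_∞`: parameters all of whose `G`-iterates stay in the interior of `U`. -/
def OmegaInf : Set (ℝ × ℝ) := {p | ∀ n : ℕ, Gmap^[n] p ∈ interior Uset}

/-- `k_i = ⌊1/α_{i−1}⌋`, where `(α_{i−1}, β_{i−1}) = G^{i−1}(α,β)`. -/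
noncomputable def kseq (p : ℝ × ℝ) (i : ℕ) : ℕ := (⌊1 / (Gmap^[i - 1] p).1⌋).toNat

theorem interior_Uset : interior Uset = {p : ℝ × ℝ | 0 < p.2 ∧ p.2 < p.1 ∧ p.1 < 1} := by
  apply subset_antisymm
  · intro p hp
    have hU : p ∈ Uset := interior_subset hp
    have hnhds : ∀ g : ℝ → ℝ × ℝ, Continuous g → g 0 = p → ∃ t > 0, g t ∈ Uset := by
      intro g hg h0
      have h1 : ∀ᶠ t in 𝓝 (0 : ℝ), g t ∈ Uset :=
        hg.continuousAt.eventually (by rw [h0]; exact mem_interior_iff_mem_nhds.1 hp)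
      have h2 : ∀ᶠ t in 𝓝[>] (0 : ℝ), g t ∈ Uset := h1.filter_mono nhdsWithin_le_nhds
      obtain ⟨t, ht, ht'⟩ := (h2.and self_mem_nhdsWithin).exists
      exact ⟨t, ht', ht⟩
    obtain ⟨t, ht, -, ht', -⟩ := hnhds (fun t => (p.1, p.2 + t)) (by fun_prop) (by simp)
    obtain ⟨s, hs, -, -, hs'⟩ := hnhds (fun t => (p.1 + t, p.2)) (by fun_prop) (by simp)
    simp only at ht' hs'
    exact ⟨hU.1, by linarith, by linarith⟩
  · apply interior_maximal
    · rintro p ⟨h1, h2, h3⟩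
      exact ⟨h1, h2.le, h3.le⟩
    · exact (isOpen_lt continuous_const continuous_snd).inter
        ((isOpen_lt continuous_snd continuous_fst).inter
          (isOpen_lt continuous_fst continuous_const))

theorem mem_OmegaInf_iff {p : ℝ × ℝ} :
    p ∈ OmegaInf ↔ ∀ n, 0 < (Gmap^[n] p).2 ∧ (Gmap^[n] p).2 < (Gmap^[n] p).1 ∧
      (Gmap^[n] p).1 < 1 := by
  simp only [OmegaInf, interior_Uset, Set.mem_ofPred_eq]

/-- The third-order recurrence with coefficients `k`, at the index `n`. -/
def RecAt {R : Type*} [CommRing R] (k : ℕ → ℕ) (z : ℕ → R) (n : ℕ) : Prop :=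
  z (n + 3) = z (n + 2) + k (n + 1) * z (n + 1) - z n

theorem RecAt.sub {R : Type*} [CommRing R] {k : ℕ → ℕ} {y z : ℕ → R} {n : ℕ}
    (hy : RecAt k y n) (hz : RecAt k z n) : RecAt k (fun i => y i - z i) n := by
  unfold RecAt at *
  linear_combination hy - hz

theorem RecAt.const_mul {R : Type*} [CommRing R] {k : ℕ → ℕ} {z : ℕ → R} {n : ℕ}
    (hz : RecAt k z n) (c : R) : RecAt k (fun i => c * z i) n := by
  unfold RecAt at *
  linear_combination c * hz

/-- The quadratic form that increases along solutions of the recurrence. -/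
noncomputable def energy (z : ℕ → ℝ) (n : ℕ) : ℝ :=
  (z (n + 1) ^ 2 + z (n + 2) ^ 2) / 2 - z n * z (n + 1)

theorem RecAt.energy_le {k : ℕ → ℕ} {z : ℕ → ℝ} {n : ℕ} (hk : 1 ≤ k (n + 1))
    (hz : RecAt k z n) : energy z n ≤ energy z (n + 1) := by
  have hk' : (1 : ℝ) ≤ k (n + 1) := by exact_mod_cast hk
  have h : energy z (n + 1) - energy z n =
      (z (n + 3) - z (n + 1)) ^ 2 / 2 + ((k (n + 1) : ℝ) - 1) * z (n + 1) ^ 2 := by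
    unfold energy RecAt at *
    linear_combination z (n + 1) * hz
  have : 0 ≤ ((k (n + 1) : ℝ) - 1) * z (n + 1) ^ 2 :=
    mul_nonneg (by linarith) (sq_nonneg _)
  nlinarith [sq_nonneg (z (n + 3) - z (n + 1))]

theorem energy_zero_le {k : ℕ → ℕ} (hk : ∀ n, 1 ≤ k (n + 1)) {z : ℕ → ℝ} (N : ℕ)
    (hz : ∀ n < N, RecAt k z n) : energy z 0 ≤ energy z N := by
  induction N with
  | zero => exact le_rfl
  | succ N ih =>
    exact (ih fun n hn => hz n (by omega)).trans ((hz N (by omega)).energy_le (hk N))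

/-- A solution of the recurrence that tends to `0` and vanishes at `0` is trivial. -/
theorem eq_zero_of_tendsto_zero {k : ℕ → ℕ} (hk : ∀ n, 1 ≤ k (n + 1)) {z : ℕ → ℝ}
    (hz : ∀ n, RecAt k z n) (h0 : z 0 = 0) (hlim : Tendsto z atTop (𝓝 0)) :
    z 1 = 0 ∧ z 2 = 0 := by
  have hshift : ∀ i, Tendsto (fun n => z (n + i)) atTop (𝓝 0) := fun i =>
    hlim.comp (tendsto_add_atTop_nat i)
  have hE : Tendsto (energy z) atTop (𝓝 0) := by
    have : Tendsto (energy z) atTop (𝓝 ((0 ^ 2 + 0 ^ 2) / 2 - 0 * 0)) :=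
      ((((hshift 1).pow 2).add ((hshift 2).pow 2)).div_const 2).sub
      (hlim.mul (hshift 1))
    simpa using this
  have h : energy z 0 ≤ 0 :=
    ge_of_tendsto' hE fun n => energy_zero_le hk n fun i _ => hz i
  simp only [energy, h0, zero_mul, sub_zero, zero_add] at h
  constructor <;> nlinarith [sq_nonneg (z 1), sq_nonneg (z 2)]

/-- A positive strictly decreasing solution of the recurrence, started at `1`. -/
structure IsLengthSeq (k : ℕ → ℕ) (x : ℕ → ℝ) : Prop where
  zero : x 0 = 1
  pos : ∀ n, 0 < x n
  anti : ∀ n, x (n + 1) < x n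
  recAt : ∀ n, RecAt k x n

theorem IsLengthSeq.exists_one_lt {k : ℕ → ℕ} {x : ℕ → ℝ} (hx : IsLengthSeq k x) (m : ℕ) :
    ∃ j, 1 < k (m + 2 * j + 1) := by
  by_contra! h
  have hstep : ∀ j, x (m + 2 * j) - x (m + 2 * j + 1) ≥ x m - x (m + 1) := by
    intro j
    induction j with
    | zero => simp
    | succ j ih =>
      have hr := hx.recAt (m + 2 * j)
      unfold RecAt at hr
      have h1 : (k (m + 2 * j + 1) : ℝ) ≤ 1 := by exact_mod_cast h j
      have h2 := hx.pos (m + 2 * j + 1)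
      have e1 : m + 2 * (j + 1) = m + 2 * j + 2 := by ring
      rw [e1]
      nlinarith
  have hsum : ∀ j : ℕ, x (m + 2 * j) ≤ x m - j * (x m - x (m + 1)) := by
    intro j
    induction j with
    | zero => simp
    | succ j ih =>
      have h1 := hstep j
      have h2 := hx.anti (m + 2 * j + 1)
      have e1 : m + 2 * (j + 1) = m + 2 * j + 1 + 1 := by ring
      rw [e1]
      push_cast
      linarith
  obtain ⟨j, hj⟩ := exists_nat_gt (x m / (x m - x (m + 1)))
  have hd : 0 < x m - x (m + 1) := sub_pos.2 (hx.anti m)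
  rw [div_lt_iff₀ hd] at hj
  linarith [hsum j, hx.pos (m + 2 * j)]

theorem IsLengthSeq.one_le {k : ℕ → ℕ} {x : ℕ → ℝ} (hx : IsLengthSeq k x) (n : ℕ) :
    1 ≤ k (n + 1) := by
  by_contra! h
  have h0 : k (n + 1) = 0 := by omega
  have hr := hx.recAt n
  simp only [RecAt, h0, Nat.cast_zero, zero_mul, add_zero] at hr
  linarith [hx.pos (n + 3), hx.anti n, hx.anti (n + 1)]

theorem IsLengthSeq.mul_prod_le_one {k : ℕ → ℕ} {x : ℕ → ℝ} (hx : IsLengthSeq k x) (n : ℕ) :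
    x n * ∏ i ∈ Finset.range n, (k (i + 1) : ℝ) ≤ 1 := by
  induction n with
  | zero => simp [hx.zero]
  | succ n ih =>
    rw [Finset.prod_range_succ]
    have hr := hx.recAt n
    unfold RecAt at hr
    have h1 : k (n + 1) * x (n + 1) ≤ x n := by linarith [hx.anti (n + 2)]
    have h2 : 0 ≤ ∏ i ∈ Finset.range n, (k (i + 1) : ℝ) := by positivity
    nlinarith

theorem IsLengthSeq.tendsto_prod {k : ℕ → ℕ} {x : ℕ → ℝ} (hx : IsLengthSeq k x) :
    Tendsto (fun n => ∏ i ∈ Finset.range n, (k (i + 1) : ℝ)) atTop atTop := by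
  have h1 : ∀ n, (1 : ℝ) ≤ k (n + 1) := fun n => by exact_mod_cast hx.one_le n
  have hpos : ∀ n, 0 < ∏ i ∈ Finset.range n, (k (i + 1) : ℝ) := fun n =>
    Finset.prod_pos fun i _ => by linarith [h1 i]
  have hmono : Monotone fun n => ∏ i ∈ Finset.range n, (k (i + 1) : ℝ) :=
    monotone_nat_of_le_succ fun n => by
      rw [Finset.prod_range_succ]
      exact le_mul_of_one_le_right (hpos n).le (h1 n)
  have hunb : ∀ m : ℕ, ∃ n, (m : ℝ) + 1 ≤ ∏ i ∈ Finset.range n, (k (i + 1) : ℝ) := by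
    intro m
    induction m with
    | zero => exact ⟨0, by simp⟩
    | succ m ih =>
      obtain ⟨n, hn⟩ := ih
      obtain ⟨j, hj⟩ := hx.exists_one_lt n
      refine ⟨n + 2 * j + 1, ?_⟩
      have h2 : (2 : ℝ) ≤ k (n + 2 * j + 1) := by exact_mod_cast hj
      have h3 := hmono (Nat.le_add_right n (2 * j))
      simp only at h3
      rw [Finset.prod_range_succ]
      push_cast
      have hm : (0 : ℝ) ≤ m := m.cast_nonneg
      nlinarith
  refine tendsto_atTop_atTop_of_monotone hmono fun b => ?_
  obtain ⟨m, hm⟩ := exists_nat_gt b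
  obtain ⟨n, hn⟩ := hunb m
  exact ⟨n, by linarith⟩

theorem IsLengthSeq.antitone {k : ℕ → ℕ} {x : ℕ → ℝ} (hx : IsLengthSeq k x) : Antitone x :=
  antitone_nat_of_succ_le fun n => (hx.anti n).le

theorem IsLengthSeq.tendsto_zero {k : ℕ → ℕ} {x : ℕ → ℝ} (hx : IsLengthSeq k x) :
    Tendsto x atTop (𝓝 0) := by
  refine squeeze_zero (fun n => (hx.pos n).le) (fun n => ?_)
    (tendsto_inv_atTop_zero.comp hx.tendsto_prod)
  have h1 : 0 < ∏ i ∈ Finset.range n, (k (i + 1) : ℝ) :=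
    Finset.prod_pos fun i _ => by exact_mod_cast hx.one_le i
  rw [Function.comp_apply, ← one_div, le_div_iff₀ h1]
  exact hx.mul_prod_le_one n

/-- Solutions of the recurrence that tend to `0` are proportional to a length sequence. -/
theorem IsLengthSeq.eq_smul {k : ℕ → ℕ} {x y : ℕ → ℝ} (hx : IsLengthSeq k x)
    (hy : ∀ n, RecAt k y n) (hlim : Tendsto y atTop (𝓝 0)) :
    y 1 = y 0 * x 1 ∧ y 2 = y 0 * x 2 := by
  have h := eq_zero_of_tendsto_zero hx.one_le
    (fun n => (hy n).sub ((hx.recAt n).const_mul (y 0))) (by simp [hx.zero])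
    (by simpa using hlim.sub (hx.tendsto_zero.const_mul (y 0)))
  exact ⟨sub_eq_zero.1 h.1, sub_eq_zero.1 h.2⟩

/-- Length sequences with the same first `n` coefficients are close at the start. -/
theorem IsLengthSeq.sq_add_sq_le {k l : ℕ → ℕ} {x y : ℕ → ℝ} (hx : IsLengthSeq k x)
    (hy : IsLengthSeq l y) (n : ℕ) (hkl : ∀ i < n, k (i + 1) = l (i + 1)) :
    (x 1 - y 1) ^ 2 + (x 2 - y 2) ^ 2 ≤
      4 * ((∏ i ∈ Finset.range n, (k (i + 1) : ℝ))⁻¹) ^ 2 := by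
  set C := (∏ i ∈ Finset.range n, (k (i + 1) : ℝ))⁻¹ with hC
  have hP : 0 < ∏ i ∈ Finset.range n, (k (i + 1) : ℝ) :=
    Finset.prod_pos fun i _ => by exact_mod_cast hx.one_le i
  have hxC : x n ≤ C := by
    rw [hC, ← one_div, le_div_iff₀ hP]
    exact hx.mul_prod_le_one n
  have hyC : y n ≤ C := by
    rw [hC, ← one_div, le_div_iff₀ hP]
    have : ∏ i ∈ Finset.range n, (k (i + 1) : ℝ) = ∏ i ∈ Finset.range n, (l (i + 1) : ℝ) :=
      Finset.prod_congr rfl fun i hi => by rw [hkl i (Finset.mem_range.1 hi)]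
    rw [this]
    exact hy.mul_prod_le_one n
  have hz : ∀ i < n, RecAt k (fun i => x i - y i) i := fun i hi => by
    refine (hx.recAt i).sub ?_
    have := hy.recAt i
    rwa [RecAt, ← hkl i hi] at this
  have hE := energy_zero_le hx.one_le n hz
  have hb : ∀ j, (x (n + j) - y (n + j)) ^ 2 ≤ C ^ 2 := fun j => by
    apply sq_le_sq'
    · linarith [hx.pos (n + j), hy.antitone (Nat.le_add_right n j)]
    · linarith [hy.pos (n + j), hx.antitone (Nat.le_add_right n j)]
  simp only [energy, hx.zero, hy.zero, sub_self, zero_mul, sub_zero, zero_add] at hE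
  have h0 := hb 0
  have h1 := hb 1
  have h2 := hb 2
  simp only [add_zero] at h0
  nlinarith [sq_nonneg (x n - y n + (x (n + 1) - y (n + 1)))]

/-- The interval lengths `α₀ α₁ ⋯ α_{n-1}` along the `G`-orbit. -/
noncomputable def lengthSeq (p : ℝ × ℝ) (n : ℕ) : ℝ :=
  ∏ i ∈ Finset.range n, (Gmap^[i] p).1

theorem kseq_succ_cast {p : ℝ × ℝ} (hp : p ∈ OmegaInf) (n : ℕ) :
    (kseq p (n + 1) : ℝ) = (⌊1 / (Gmap^[n] p).1⌋ : ℝ) := by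
  obtain ⟨h1, h2, h3⟩ := mem_OmegaInf_iff.1 hp n
  have h : 0 ≤ ⌊1 / (Gmap^[n] p).1⌋ := Int.floor_nonneg.2 (by
    have : 0 < (Gmap^[n] p).1 := h1.trans h2
    positivity)
  have h' : ((kseq p (n + 1) : ℤ)) = ⌊1 / (Gmap^[n] p).1⌋ := by
    simp only [kseq, Nat.add_sub_cancel, Int.toNat_of_nonneg h]
  rw [← h']
  norm_cast

theorem isLengthSeq_lengthSeq {p : ℝ × ℝ} (hp : p ∈ OmegaInf) :
    IsLengthSeq (kseq p) (lengthSeq p) := by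
  have hp' := mem_OmegaInf_iff.1 hp
  have hpos : ∀ n, 0 < (Gmap^[n] p).1 := fun n => (hp' n).1.trans (hp' n).2.1
  have hpos' : ∀ n, 0 < lengthSeq p n := fun n => Finset.prod_pos fun i _ => hpos i
  have hsucc : ∀ n, lengthSeq p (n + 1) = lengthSeq p n * (Gmap^[n] p).1 := fun n =>
    Finset.prod_range_succ _ _
  refine ⟨by simp [lengthSeq], hpos', fun n => ?_, fun n => ?_⟩
  · rw [hsucc]
    exact mul_lt_of_lt_one_right (hpos' n) (hp' n).2.2
  · have hG : ∀ m, (Gmap^[m] p).1 * (Gmap^[m + 1] p).1 = (Gmap^[m] p).2 := fun m => by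
      rw [Function.iterate_succ_apply', Gmap]
      have := (hpos m).ne'
      field_simp
    have hG2 : (Gmap^[n] p).1 * (Gmap^[n + 1] p).2 =
        (Gmap^[n] p).2 - 1 + kseq p (n + 1) * (Gmap^[n] p).1 := by
      rw [kseq_succ_cast hp, Function.iterate_succ_apply', Gmap]
      have := (hpos n).ne'
      field_simp
    unfold RecAt
    rw [hsucc (n + 2), hsucc (n + 1), hsucc n]
    linear_combination (lengthSeq p n * (Gmap^[n] p).1) * hG (n + 1) +
      lengthSeq p n * hG2 - lengthSeq p n * hG n

theorem lengthSeq_one (p : ℝ × ℝ) : lengthSeq p 1 = p.1 := by simp [lengthSeq]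

theorem lengthSeq_two {p : ℝ × ℝ} (hp : p ∈ OmegaInf) : lengthSeq p 2 = p.2 := by
  obtain ⟨h1, h2, -⟩ := mem_OmegaInf_iff.1 hp 0
  have : p.1 ≠ 0 := (h1.trans h2).ne'
  simp only [lengthSeq, Finset.prod_range_succ, Finset.range_zero, Finset.prod_empty,
    Function.iterate_zero, id, Function.iterate_one, Gmap, one_mul]
  field_simp

theorem starCond_kseq {p : ℝ × ℝ} (hp : p ∈ OmegaInf) : StarCond (kseq p) := by
  have hx := isLengthSeq_lengthSeq hp
  constructor <;> intro N
  · obtain ⟨j, hj⟩ := hx.exists_one_lt (2 * N + 1)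
    exact ⟨N + j + 1, by omega, by convert hj using 2; ring⟩
  · obtain ⟨j, hj⟩ := hx.exists_one_lt (2 * N)
    refine ⟨N + j + 1, by omega, ?_⟩
    have : 2 * (N + j + 1) - 1 = 2 * N + 2 * j + 1 := by omega
    rwa [this]

/-- The inverse branch of `Gmap` on which `⌊1 / α⌋ = k`. -/
noncomputable def invBranch (k : ℕ) (q : ℝ × ℝ) : ℝ × ℝ :=
  (1 / (k + q.1 - q.2), q.1 / (k + q.1 - q.2))

theorem floor_invBranch {k : ℕ} {q : ℝ × ℝ} (h0 : 0 < q.2) (h1 : q.2 < q.1) (h2 : q.1 < 1) :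
    ⌊1 / (invBranch k q).1⌋ = k := by
  rw [invBranch, one_div_one_div, Int.floor_eq_iff]
  constructor <;> push_cast <;> linarith

theorem Gmap_invBranch {k : ℕ} (hk : 1 ≤ k) {q : ℝ × ℝ} (h0 : 0 < q.2) (h1 : q.2 < q.1)
    (h2 : q.1 < 1) : Gmap (invBranch k q) = q := by
  have hk' : (1 : ℝ) ≤ k := by exact_mod_cast hk
  have hD : (k + q.1 - q.2 : ℝ) ≠ 0 := by linarith
  ext
  · simp only [Gmap, invBranch]
    field_simp
  · rw [Gmap, floor_invBranch h0 h1 h2]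
    simp only [invBranch]
    push_cast
    field_simp
    ring

theorem invBranch_mem {k : ℕ} (hk : 1 ≤ k) {q : ℝ × ℝ} (hq : q ∈ OmegaInf) :
    invBranch k q ∈ OmegaInf := by
  obtain ⟨h0, h1, h2⟩ := mem_OmegaInf_iff.1 hq 0
  simp only [Function.iterate_zero, id] at h0 h1 h2
  have hk' : (1 : ℝ) ≤ k := by exact_mod_cast hk
  have hD : (0 : ℝ) < k + q.1 - q.2 := by linarith
  rw [mem_OmegaInf_iff]
  rintro (_ | n)
  · simp only [Function.iterate_zero, id, invBranch]
    refine ⟨div_pos (h0.trans h1) hD, (div_lt_div_iff_of_pos_right hD).2 h2, ?_⟩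
    rw [div_lt_one hD]
    linarith
  · rw [Function.iterate_succ_apply, Gmap_invBranch hk h0 h1 h2]
    exact mem_OmegaInf_iff.1 hq n

/-- `1, α, β` are linearly independent over the integers. -/
def RatIndep (p : ℝ × ℝ) : Prop :=
  ∀ a b c : ℤ, a + b * p.1 + c * p.2 = 0 → a = 0 ∧ b = 0 ∧ c = 0

theorem RatIndep.irrational {p : ℝ × ℝ} (hp : RatIndep p) : Irrational (p.1 - p.2) := by
  rw [irrational_iff_ne_rational]
  intro a b hb h
  have hb' : (b : ℝ) ≠ 0 := by exact_mod_cast hb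
  have := hp (-a) b (-b) (by
    rw [eq_div_iff hb'] at h
    push_cast
    linarith)
  exact hb this.2.1

theorem RatIndep.invBranch {k : ℕ} {q : ℝ × ℝ} (hq : RatIndep q)
    (hD : (k + q.1 - q.2 : ℝ) ≠ 0) : RatIndep (invBranch k q) := by
  intro a b c h
  simp only [_root_.invBranch] at h
  field_simp at h
  have := hq (a * k + b) (a + c) (-a) (by push_cast; linarith)
  have ha : a = 0 := by simpa using this.2.2
  subst ha
  simpa using this

/-- Cubic form controlling the integer relations between `1, l, l²` for the fixed point below. -/
theorem cubic_det_eq_zero {l : ℝ} (hl : l ^ 3 = l ^ 2 + 2 * l - 1) {a b c : ℤ}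
    (h : a + b * l + c * l ^ 2 = 0) :
    Matrix.det !![a, b, c; -c, a + 2 * c, b + c; -(b + c), -c + 2 * (b + c), a + 2 * c + (b + c)]
      = 0 := by
  have h1 : ((-c : ℤ) : ℝ) + (a + 2 * c : ℤ) * l + (b + c : ℤ) * l ^ 2 = 0 := by
    push_cast
    linear_combination l * h - c * hl
  have h2 : ((-(b + c) : ℤ) : ℝ) + (-c + 2 * (b + c) : ℤ) * l +
      (a + 2 * c + (b + c) : ℤ) * l ^ 2 = 0 := by
    push_cast at h1 ⊢
    linear_combination l * h1 - (b + c) * hl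
  rw [Matrix.det_fin_three]
  simp only [Matrix.of_apply, Matrix.cons_val]
  push_cast at h1 h2
  have : ((a * (a + 2 * c) * (a + 2 * c + (b + c)) - a * (b + c) * (-c + 2 * (b + c)) -
      b * (-c) * (a + 2 * c + (b + c)) + b * (b + c) * (-(b + c)) +
      c * (-c) * (-c + 2 * (b + c)) - c * (a + 2 * c) * (-(b + c)) : ℤ) : ℝ) = 0 := by
    push_cast
    linear_combination
      ((a + 2 * c) * (a + 2 * c + (b + c)) - (b + c) * (-c + 2 * (b + c)) : ℝ) * h -
      (b * (a + 2 * c + (b + c)) - c * (-c + 2 * (b + c)) : ℝ) * h1 +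
      (b * (b + c) - c * (a + 2 * c) : ℝ) * h2
  exact_mod_cast this

theorem even_of_cubic_det_eq_zero {a b c : ℤ}
    (h : Matrix.det !![a, b, c; -c, a + 2 * c, b + c;
      -(b + c), -c + 2 * (b + c), a + 2 * c + (b + c)] = 0) : 2 ∣ a ∧ 2 ∣ b ∧ 2 ∣ c := by
  have key : ∀ x y z : ZMod 2, x * (x + 2 * z) * (x + 2 * z + (y + z)) -
      x * (y + z) * (-z + 2 * (y + z)) - y * (-z) * (x + 2 * z + (y + z)) +
      y * (y + z) * (-(y + z)) + z * (-z) * (-z + 2 * (y + z)) -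
      z * (x + 2 * z) * (-(y + z)) = 0 → x = 0 ∧ y = 0 ∧ z = 0 := by decide
  rw [Matrix.det_fin_three] at h
  simp only [Matrix.of_apply, Matrix.cons_val] at h
  have h' := congrArg (Int.cast : ℤ → ZMod 2) h
  push_cast at h'
  simpa only [ZMod.intCast_zmod_eq_zero_iff_dvd, Nat.cast_ofNat] using key a b c h'

theorem ratIndep_of_cubic {l : ℝ} (hl : l ^ 3 = l ^ 2 + 2 * l - 1) : RatIndep (l, l ^ 2) := by
  have key : ∀ n : ℕ, ∀ a b c : ℤ, a.natAbs + b.natAbs + c.natAbs ≤ n →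
      a + b * l + c * l ^ 2 = 0 → a = 0 ∧ b = 0 ∧ c = 0 := by
    intro n
    induction n with
    | zero => intro a b c h _; omega
    | succ n ih =>
      intro a b c hn h
      obtain ⟨⟨a', rfl⟩, ⟨b', rfl⟩, ⟨c', rfl⟩⟩ :=
        even_of_cubic_det_eq_zero (cubic_det_eq_zero hl h)
      by_cases h0 : a' = 0 ∧ b' = 0 ∧ c' = 0
      · obtain ⟨rfl, rfl, rfl⟩ := h0
        simp
      · have := ih a' b' c' (by omega) (by push_cast at h; linarith)
        exact absurd this h0
  exact fun a b c h => key _ a b c le_rfl h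

theorem exists_ratIndep_mem_OmegaInf : ∃ q ∈ OmegaInf, RatIndep q := by
  obtain ⟨l, ⟨hl0, hl1⟩, hl⟩ : (0 : ℝ) ∈ (fun t : ℝ => t ^ 2 + 2 * t - 1 - t ^ 3) '' Set.Ioo 0 1 :=
    intermediate_value_Ioo zero_le_one (by fun_prop) (by norm_num)
  have hl' : l ^ 3 = l ^ 2 + 2 * l - 1 := by simp only at hl; linarith
  have h1 : l ^ 2 < l := by nlinarith
  have h0 : 0 < l ^ 2 := by positivity
  have hfix : invBranch 2 (l, l ^ 2) = (l, l ^ 2) := by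
    have hD : (2 + l - l ^ 2 : ℝ) ≠ 0 := by nlinarith
    ext
    · simp only [invBranch, Nat.cast_ofNat]
      rw [div_eq_iff hD]
      linarith
    · simp only [invBranch, Nat.cast_ofNat]
      rw [div_eq_iff hD]
      linear_combination l * hl'
  have hG : Gmap (l, l ^ 2) = (l, l ^ 2) := by
    conv_lhs => rw [← hfix]
    exact Gmap_invBranch (by norm_num) h0 h1 hl1
  refine ⟨(l, l ^ 2), mem_OmegaInf_iff.2 fun n => ?_, ratIndep_of_cubic hl'⟩
  rw [Function.iterate_fixed hG]
  exact ⟨h0, h1, hl1⟩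

theorem kseq_Gmap (p : ℝ × ℝ) (n : ℕ) : kseq (Gmap p) (n + 1) = kseq p (n + 2) := by
  simp [kseq, Function.iterate_succ_apply]

theorem exists_ratIndep_kseq_eq (n : ℕ) : ∀ p ∈ OmegaInf,
    ∃ q ∈ OmegaInf, RatIndep q ∧ ∀ i < n, kseq p (i + 1) = kseq q (i + 1) := by
  induction n with
  | zero =>
    intro p _
    obtain ⟨q, hq, hq'⟩ := exists_ratIndep_mem_OmegaInf
    exact ⟨q, hq, hq', by simp⟩
  | succ n ih =>
    intro p hp
    have hGp : Gmap p ∈ OmegaInf := fun m => by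
      rw [← Function.iterate_succ_apply]
      exact hp (m + 1)
    obtain ⟨q, hq, hq', hqk⟩ := ih _ hGp
    have hk := (isLengthSeq_lengthSeq hp).one_le 0
    obtain ⟨h0, h1, h2⟩ := mem_OmegaInf_iff.1 hq 0
    simp only [Function.iterate_zero, id] at h0 h1 h2
    have hk' : (1 : ℝ) ≤ kseq p 1 := by exact_mod_cast hk
    refine ⟨invBranch (kseq p 1) q, invBranch_mem hk hq, hq'.invBranch (by linarith), ?_⟩
    rintro (_ | i) hi
    · change kseq p 1 = (⌊1 / (invBranch (kseq p 1) q).1⌋).toNat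
      rw [floor_invBranch h0 h1 h2, Int.toNat_natCast]
    · rw [← kseq_Gmap, ← kseq_Gmap, Gmap_invBranch hk h0 h1 h2]
      exact hqk i (by omega)

theorem dense_irrational_sub :
    Dense {p : ↥OmegaInf | Irrational (p.1.1 - p.1.2)} := by
  rw [Metric.dense_iff]
  rintro ⟨p, hp⟩ r hr
  have hx := isLengthSeq_lengthSeq hp
  obtain ⟨n, hn⟩ := (((tendsto_inv_atTop_zero.comp hx.tendsto_prod).eventually
    (gt_mem_nhds (half_pos hr)))).exists
  obtain ⟨q, hq, hqi, hqk⟩ := exists_ratIndep_kseq_eq n p hp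
  have hP : 0 < ∏ i ∈ Finset.range n, (kseq p (i + 1) : ℝ) :=
    Finset.prod_pos fun i _ => by exact_mod_cast hx.one_le i
  have h := hx.sq_add_sq_le (isLengthSeq_lengthSeq hq) n hqk
  rw [lengthSeq_one, lengthSeq_one, lengthSeq_two hp, lengthSeq_two hq] at h
  simp only [Function.comp_apply] at hn
  have hC := inv_pos.2 hP
  refine ⟨⟨q, hq⟩, ?_, hqi.irrational⟩
  rw [Metric.mem_ball, Subtype.dist_eq, dist_comm, Prod.dist_eq, max_lt_iff, Real.dist_eq,
    Real.dist_eq]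
  constructor
  · refine abs_lt_of_sq_lt_sq ?_ hr.le
    nlinarith [sq_nonneg (p.2 - q.2)]
  · refine abs_lt_of_sq_lt_sq ?_ hr.le
    nlinarith [sq_nonneg (p.1 - q.1)]

theorem isGδ_irrational_sub :
    IsGδ {p : ↥OmegaInf | Irrational (p.1.1 - p.1.2)} :=
  IsGδ.setOfPred_irrational.preimage (f := fun p : ↥OmegaInf => p.1.1 - p.1.2) (by fun_prop)

theorem applyChi_append (k : ℕ) (u v : List (Fin 3)) :
    applyChi k (u ++ v) = applyChi k u ++ applyChi k v := by
  simp [applyChi]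

theorem applyChi_zero (k : ℕ) : applyChi k [0] = [1] := by simp [applyChi, chiSub]

theorem applyChi_one (k : ℕ) : applyChi k [1] = 2 :: List.replicate k 0 := by
  simp [applyChi, chiSub]

theorem applyChi_two (k : ℕ) : applyChi k [2] = 2 :: List.replicate (k - 1) 0 := by
  simp [applyChi, chiSub]

theorem applyChi_singleton_ne_nil (k : ℕ) (a : Fin 3) : applyChi k [a] ≠ [] := by
  fin_cases a <;> simp [applyChi, chiSub]

theorem length_le_length_applyChi (k : ℕ) (w : List (Fin 3)) :
    w.length ≤ (applyChi k w).length := by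
  induction w with
  | nil => simp
  | cons a w ih =>
    have h := List.length_pos_iff.2 (applyChi_singleton_ne_nil k a)
    rw [← List.singleton_append, applyChi_append, List.length_append, List.length_append]
    simp only [List.length_singleton]
    omega

theorem compApply_append (k : ℕ → ℕ) (n : ℕ) : ∀ u v : List (Fin 3),
    compApply k n (u ++ v) = compApply k n u ++ compApply k n v := by
  induction n with
  | zero => intro u v; rfl
  | succ n ih => intro u v; simp only [compApply, applyChi_append, ih]

theorem length_le_length_compApply (k : ℕ → ℕ) (n : ℕ) : ∀ w : List (Fin 3),
    w.length ≤ (compApply k n w).length := by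
  induction n with
  | zero => intro w; exact le_rfl
  | succ n ih => intro w; exact (length_le_length_applyChi _ w).trans (ih _)

theorem length_compApply_replicate (k : ℕ → ℕ) (n j : ℕ) (a : Fin 3) :
    (compApply k n (List.replicate j a)).length = j * (compApply k n [a]).length := by
  induction j with
  | zero =>
    have : ∀ n, compApply k n [] = [] := fun n => by
      induction n with
      | zero => rfl
      | succ n ih => simpa [compApply, applyChi] using ih
    simp [this]
  | succ j ih =>
    rw [List.replicate_succ', compApply_append, List.length_append, ih]
    ring

/-- The heights `|χ_{k_1} ⋯ χ_{k_n}(1)|`, shifted by one index and preceded by `0`. -/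
def height (k : ℕ → ℕ) : ℕ → ℕ
  | 0 => 0
  | n + 1 => (compApply k n [0]).length

theorem length_compApply_one (k : ℕ → ℕ) (n : ℕ) :
    (compApply k n [1]).length = height k (n + 2) := by
  simp only [height, compApply, applyChi_zero]

theorem length_compApply_succ_two (k : ℕ → ℕ) (n : ℕ) :
    (compApply k (n + 1) [2]).length =
      (compApply k n [2]).length + (k (n + 1) - 1) * height k (n + 1) := by
  rw [compApply, applyChi_two, ← List.singleton_append, compApply_append, List.length_append,
    length_compApply_replicate]
  rfl

theorem height_add_three (k : ℕ → ℕ) (n : ℕ) :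
    height k (n + 3) = (compApply k n [2]).length + k (n + 1) * height k (n + 1) := by
  rw [← length_compApply_one, compApply, applyChi_one, ← List.singleton_append,
    compApply_append, List.length_append, length_compApply_replicate]
  rfl

theorem length_compApply_two_add_height {k : ℕ → ℕ} (hk : ∀ n, 1 ≤ k (n + 1)) (n : ℕ) :
    (compApply k n [2]).length + height k n = height k (n + 2) := by
  cases n with
  | zero => simp [compApply, height, applyChi, chiSub]
  | succ n =>
    rw [length_compApply_succ_two, height_add_three]
    obtain ⟨c, hc⟩ := Nat.exists_eq_add_of_le' (hk n)
    rw [hc, Nat.add_sub_cancel]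
    ring

theorem recAt_height {k : ℕ → ℕ} (hk : ∀ n, 1 ≤ k (n + 1)) (n : ℕ) :
    RecAt k (fun i => (height k i : ℝ)) n := by
  have h1 : (height k (n + 3) : ℝ) = (compApply k n [2]).length + k (n + 1) * height k (n + 1) :=
    mod_cast height_add_three k n
  have h2 : ((compApply k n [2]).length + height k n : ℝ) = height k (n + 2) :=
    mod_cast length_compApply_two_add_height hk n
  unfold RecAt
  linarith

theorem exists_length_compApply_ge {k : ℕ → ℕ} (hstar : ∀ m, ∃ j, 1 < k (m + 2 * j + 1))
    (L : ℕ) : ∃ N, ∀ n ≥ N, L ≤ (compApply k n [2]).length := by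
  have hmono : Monotone fun n => (compApply k n [2]).length :=
    monotone_nat_of_le_succ fun n => by
      rw [length_compApply_succ_two]
      exact Nat.le_add_right _ _
  suffices ∃ N, L ≤ (compApply k N [2]).length by
    obtain ⟨N, hN⟩ := this
    exact ⟨N, fun n hn => hN.trans (hmono hn)⟩
  induction L with
  | zero => exact ⟨0, Nat.zero_le _⟩
  | succ L ih =>
    obtain ⟨N, hN⟩ := ih
    obtain ⟨j, hj⟩ := hstar N
    refine ⟨N + 2 * j + 1, ?_⟩
    have h1 := hmono (Nat.le_add_right N (2 * j))
    have h2 : 1 ≤ height k (N + 2 * j + 1) := length_le_length_compApply k _ [0]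
    have h3 : 1 ≤ (k (N + 2 * j + 1) - 1) * height k (N + 2 * j + 1) :=
      Nat.mul_pos (by omega) h2
    simp only at h1
    rw [length_compApply_succ_two]
    omega

/-- The word `χ_{k_{m+1}} ∘ ⋯ ∘ χ_{k_{m+r}}(3)`. -/
def tailWord (k : ℕ → ℕ) : ℕ → ℕ → List (Fin 3)
  | _, 0 => [2]
  | m, r + 1 => applyChi (k (m + 1)) (tailWord k (m + 1) r)

theorem compApply_tailWord (k : ℕ → ℕ) (r : ℕ) : ∀ m,
    compApply k m (tailWord k m r) = compApply k (m + r) [2] := by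
  induction r with
  | zero => intro m; rfl
  | succ r ih =>
    intro m
    rw [tailWord, ← compApply, ih, Nat.succ_add_eq_add_succ]

/-- `u` is a proper prefix of a tail word of level `m`. -/
def IsProperPrefix (k : ℕ → ℕ) (m : ℕ) (u : List (Fin 3)) : Prop :=
  ∃ r b v, tailWord k m r = u ++ b :: v

theorem IsProperPrefix.applyChi {k : ℕ → ℕ} {m : ℕ} {u : List (Fin 3)} {a : Fin 3}
    (h : IsProperPrefix k (m + 1) (u ++ [a])) {s t : List (Fin 3)}
    (hst : applyChi (k (m + 1)) [a] = s ++ t) :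
    IsProperPrefix k m (applyChi (k (m + 1)) u ++ s) := by
  obtain ⟨r, b, v, hr⟩ := h
  have h1 : t ++ (_root_.applyChi (k (m + 1)) [b] ++ _root_.applyChi (k (m + 1)) v) ≠ [] := by
    simp [applyChi_singleton_ne_nil]
  obtain ⟨b', v', hb⟩ := List.exists_cons_of_ne_nil h1
  refine ⟨r + 1, b', v', ?_⟩
  rw [tailWord, hr, ← hb, applyChi_append, applyChi_append, hst, ← List.singleton_append (l := v),
    applyChi_append]
  simp only [List.append_assoc]

theorem exists_tailWord_eq_cons (k : ℕ → ℕ) (r : ℕ) : ∀ m, ∃ v, tailWord k m r = 2 :: v := by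
  induction r with
  | zero => exact fun m => ⟨[], rfl⟩
  | succ r ih =>
    intro m
    obtain ⟨v, hv⟩ := ih (m + 1)
    refine ⟨List.replicate (k (m + 1) - 1) 0 ++ applyChi (k (m + 1)) v, ?_⟩
    rw [tailWord, hv, ← List.singleton_append, applyChi_append, applyChi_two]
    simp

theorem isProperPrefix_two {k : ℕ → ℕ} (hstar : ∀ m, ∃ j, 1 < k (m + 2 * j + 1)) (m : ℕ) :
    IsProperPrefix k m [2] := by
  have h : ∀ r m, 1 < k (m + r + 1) → 2 ≤ (tailWord k m (r + 1)).length := by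
    intro r
    induction r with
    | zero =>
      intro m hm
      simp only [tailWord, applyChi_two, List.length_cons, List.length_replicate]
      simp only [add_zero] at hm
      omega
    | succ r ih =>
      intro m hm
      rw [tailWord]
      exact (ih (m + 1) (by convert hm using 2; ring)).trans (length_le_length_applyChi _ _)
  obtain ⟨j, hj⟩ := hstar m
  have h2 := h _ m hj
  obtain ⟨v, hv⟩ := exists_tailWord_eq_cons k (2 * j + 1) m
  rw [hv] at h2
  obtain ⟨b, v', rfl⟩ : ∃ b v', v = b :: v' := List.exists_cons_of_ne_nil (by
    rintro rfl
    simp at h2)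
  exact ⟨_, b, v', hv⟩

theorem exists_isProperPrefix_zero {k : ℕ → ℕ} (hk : ∀ n, 1 ≤ k (n + 1))
    (hstar : ∀ m, ∃ j, 1 < k (m + 2 * j + 1)) (m : ℕ) : ∃ u, IsProperPrefix k m (u ++ [0]) := by
  obtain ⟨j, hj⟩ := hstar m
  induction j generalizing m with
  | zero =>
    have h := isProperPrefix_two hstar (m + 1)
    obtain ⟨c, hc⟩ := Nat.exists_eq_add_of_le' (show 1 ≤ k (m + 1) - 1 by simp at hj; omega)
    have := IsProperPrefix.applyChi (u := []) h (s := [2] ++ [0]) (t := List.replicate c 0)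
      (by rw [applyChi_two, hc, List.replicate_succ]; rfl)
    rw [← List.append_assoc] at this
    exact ⟨_, this⟩
  | succ j ih =>
    obtain ⟨u, hu⟩ := ih (m + 2) (by convert hj using 2; ring)
    have h1 := hu.applyChi (s := [1]) (t := []) (by rw [applyChi_zero]; rfl)
    obtain ⟨c, hc⟩ := Nat.exists_eq_add_of_le' (hk m)
    have := h1.applyChi (s := [2] ++ [0]) (t := List.replicate c 0)
      (by rw [applyChi_one, hc, List.replicate_succ]; rfl)
    rw [← List.append_assoc] at this
    exact ⟨_, this⟩

/-- Runs of the letter `1` of length `k_{m+1}` occur at level `m`. -/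
theorem exists_isProperPrefix_replicate {k : ℕ → ℕ} (hk : ∀ n, 1 ≤ k (n + 1))
    (hstar : ∀ m, ∃ j, 1 < k (m + 2 * j + 1)) (m : ℕ) :
    ∃ u, ∀ j ≤ k (m + 1), IsProperPrefix k m (u ++ List.replicate j 0) := by
  obtain ⟨u, hu⟩ := exists_isProperPrefix_zero hk hstar (m + 2)
  have h1 := hu.applyChi (s := [1]) (t := []) (by rw [applyChi_zero]; rfl)
  refine ⟨applyChi (k (m + 1)) (applyChi (k (m + 2)) u) ++ [2], fun j hj => ?_⟩
  obtain ⟨c, hc⟩ := Nat.exists_eq_add_of_le hj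
  have := h1.applyChi (s := [2] ++ List.replicate j 0) (t := List.replicate c 0)
    (by rw [applyChi_one, hc, List.replicate_add]; rfl)
  rwa [← List.append_assoc] at this

theorem exists_applyChi_applyChi_eq_cons {k l : ℕ} (b : Fin 3) :
    ∃ v, applyChi k (applyChi l [b]) = [2] ++ v := by
  fin_cases b <;> simp [applyChi, chiSub]

theorem IsPrefixSeq.getElem_eq {w : List (Fin 3)} {x : ℕ → Fin 3} (h : IsPrefixSeq w x) {i : ℕ}
    (hi : i < w.length) : w[i] = x i := by
  unfold IsPrefixSeq at h
  have : w[i]? = (List.ofFn fun i : Fin w.length => x i)[i]? := congrArg (·[i]?) h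
  rw [List.getElem?_eq_getElem hi, List.getElem?_eq_getElem (by simpa using hi)] at this
  simpa using this

/-- At the block boundaries of level `m + 2`, the sequence `ρ` restarts. -/
theorem IsProperPrefix.eq_shift {k : ℕ → ℕ} {ρ : ℕ → Fin 3}
    (hρ : ∀ n, IsPrefixSeq (compApply k n [2]) ρ) {m : ℕ} {u : List (Fin 3)}
    (hu : IsProperPrefix k (m + 2) u) {i : ℕ} (hi : i < (compApply k m [2]).length) :
    ρ (i + (compApply k (m + 2) u).length) = ρ i := by
  obtain ⟨r, b, v, hr⟩ := hu
  obtain ⟨w, hw⟩ := exists_applyChi_applyChi_eq_cons (k := k (m + 1)) (l := k (m + 2)) b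
  have h1 := hρ (m + 2 + r)
  have h2 : compApply k (m + 2 + r) [2] = compApply k (m + 2) u ++ (compApply k m [2] ++
      (compApply k m w ++ compApply k (m + 2) v)) := by
    rw [← compApply_tailWord, hr, ← List.singleton_append, compApply_append, compApply_append]
    congr 1
    rw [← List.append_assoc]
    congr 1
    rw [compApply, compApply, hw, compApply_append]
  have h3 := (hρ m).getElem_eq hi
  rw [h2] at h1
  rw [← h1.getElem_eq (by simp only [List.length_append]; omega), ← h3,
    List.getElem_append_right (by omega), List.getElem_append_left (by omega)]
  simp

theorem tail_mem_orbitClosure (ρ : ℕ → Fin 3) (n : ℕ) :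
    (fun i => ρ (i + n)) ∈ orbitClosure ρ :=
  subset_closure ⟨n, rfl⟩

/-- Along block boundaries of high level, a continuous eigenvalue is close to `1`. -/
theorem IsCtsEigenvalue.exists_norm_pow_sub_one_lt {k : ℕ → ℕ} {ρ : ℕ → Fin 3} {c : ℂ}
    (hc : IsCtsEigenvalue (orbitClosure ρ) c)
    (hρ : ∀ n, IsPrefixSeq (compApply k n [2]) ρ)
    (hstar : ∀ m, ∃ j, 1 < k (m + 2 * j + 1)) {ε : ℝ} (hε : 0 < ε) :
    ∃ M, ∀ m ≥ M, ∀ u, IsProperPrefix k m u → ‖c ^ (compApply k m u).length - 1‖ < ε := by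
  obtain ⟨f, hf, ⟨x, hxX, hx0⟩, hfs⟩ := hc
  have hmem := tail_mem_orbitClosure ρ
  have hρX : ρ ∈ orbitClosure ρ := hmem 0
  have hpow : ∀ n, f (fun i => ρ (i + n)) = c ^ n * f ρ := by
    intro n
    induction n with
    | zero => simp
    | succ n ih =>
      have h1 : (fun i => ρ (i + (n + 1))) = shift fun i => ρ (i + n) := by
        funext i
        simp only [shift]
        congr 1
        ring
      rw [h1, hfs _ (hmem n), ih]
      ring
  have hfρ : f ρ ≠ 0 := by
    intro h0
    have hzero : Set.EqOn f (fun _ => 0) {y | ∃ n : ℕ, y = fun i => ρ (i + n)} := by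
      rintro _ ⟨n, rfl⟩
      simp [hpow, h0]
    exact hx0 (hzero.of_subset_closure hf continuousOn_const subset_closure subset_rfl hxX)
  have hnhds : ∀ᶠ y in 𝓝[orbitClosure ρ] ρ, ‖f y - f ρ‖ < ε * ‖f ρ‖ := by
    have := Metric.tendsto_nhds.1 (hf ρ hρX) (ε * ‖f ρ‖) (by positivity)
    simpa only [dist_eq_norm] using this
  rw [eventually_nhdsWithin_iff] at hnhds
  obtain ⟨_, ⟨z, L, rfl⟩, hz, hL⟩ :=
    (PiNat.isTopologicalBasis_cylinders fun _ : ℕ => Fin 3).mem_nhds_iff.1 hnhds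
  obtain ⟨N, hN⟩ := exists_length_compApply_ge hstar L
  refine ⟨N + 2, fun m hm u hu => ?_⟩
  obtain ⟨m, rfl⟩ := Nat.exists_eq_add_of_le' ((Nat.le_add_left 2 N).trans hm)
  have h1 : (fun i => ρ (i + (compApply k (m + 2) u).length)) ∈ PiNat.cylinder z L := by
    intro i hi
    beta_reduce
    rw [hu.eq_shift hρ (hi.trans_le (hN m (by omega)))]
    exact hz i hi
  have h2 := hL h1 (hmem _)
  rw [hpow, ← sub_one_mul, norm_mul] at h2
  exact lt_of_mul_lt_mul_right h2 (norm_nonneg _)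

theorem four_mul_abs_sub_round_le (θ : ℝ) :
    4 * |θ - round θ| ≤ ‖Complex.exp (2 * Real.pi * Complex.I * θ) - 1‖ := by
  have h1 : Complex.exp (2 * Real.pi * Complex.I * θ) =
      Complex.exp (Complex.I * (2 * Real.pi * (θ - round θ) : ℝ)) := by
    rw [Complex.exp_eq_exp_iff_exists_int]
    refine ⟨round θ, ?_⟩
    push_cast
    ring
  have h2 := Real.mul_abs_le_abs_sin (x := 2 * Real.pi * (θ - round θ) / 2) (by
    rw [show 2 * Real.pi * (θ - round θ) / 2 = Real.pi * (θ - round θ) by ring, abs_mul,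
      abs_of_pos Real.pi_pos]
    nlinarith [abs_sub_round θ, Real.pi_pos])
  rw [h1, Complex.norm_exp_I_mul_ofReal_sub_one, norm_mul, Real.norm_eq_abs, Real.norm_eq_abs,
    abs_two]
  rw [show 2 * Real.pi * (θ - round θ) / 2 = Real.pi * (θ - round θ) by ring, abs_mul,
    abs_of_pos Real.pi_pos, ← mul_assoc, div_mul_cancel₀ _ Real.pi_ne_zero] at h2
  rw [show 2 * Real.pi * (θ - round θ) / 2 = Real.pi * (θ - round θ) by ring]
  linarith

/-- If all multiples `j θ` with `j ≤ K` are near integers, then so are they for the trivial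
reason. -/
theorem abs_mul_sub_lt_of_forall_near_int {θ ε : ℝ} (hε : 0 < ε) (hε' : ε ≤ 1 / 4) {K : ℕ}
    {m : ℤ} (hm : |θ - m| < ε) (h : ∀ j : ℕ, j ≤ K → ∃ n : ℤ, |j * θ - n| < ε) (j : ℕ)
    (hj : j ≤ K) : |j * (θ - m)| < ε := by
  induction j with
  | zero => simpa using hε
  | succ j ih =>
    have ih := ih (by omega)
    obtain ⟨n, hn⟩ := h (j + 1) hj
    rw [abs_lt] at *
    push_cast at hn ⊢
    have h0 : n - (j + 1) * m = 0 := by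
      have h1 : ((n - (j + 1) * m : ℤ) : ℝ) < 1 := by push_cast; linarith
      have h2 : (-1 : ℝ) < ((n - (j + 1) * m : ℤ) : ℝ) := by push_cast; linarith
      have h3 : n - (j + 1) * m < 1 := by exact_mod_cast h1
      have h4 : -1 < n - (j + 1) * m := by exact_mod_cast h2
      omega
    have h0' : (n : ℝ) - (j + 1) * m = 0 := by exact_mod_cast h0
    constructor <;> linarith

/-- An integer solution of the recurrence from `N` on extends backwards to all indices. -/
theorem exists_recAt_extension (k : ℕ → ℕ) (N : ℕ) : ∀ m : ℕ → ℤ, (∀ n ≥ N, RecAt k m n) →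
    ∃ m' : ℕ → ℤ, (∀ n, RecAt k m' n) ∧ ∀ n ≥ N, m' n = m n := by
  induction N with
  | zero => exact fun m hm => ⟨m, fun n => hm n n.zero_le, fun _ _ => rfl⟩
  | succ N ih =>
    intro m hm
    obtain ⟨m', h1, h2⟩ := ih
      (Function.update m N (m (N + 2) + k (N + 1) * m (N + 1) - m (N + 3))) (by
        intro n hn
        rcases hn.eq_or_lt with rfl | hn
        · simp [RecAt]
        · have := hm n hn
          unfold RecAt at *
          rwa [Function.update_of_ne (by omega), Function.update_of_ne (by omega),
            Function.update_of_ne (by omega), Function.update_of_ne (by omega)])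
    exact ⟨m', h1, fun n hn => by rw [h2 n (by omega), Function.update_of_ne (by omega)]⟩

/-- The heights multiplied by `ξ` are strongly close to integers if `exp (2 π i ξ)` is a
continuous eigenvalue. -/
theorem exists_abs_mul_height_sub_round_lt {k : ℕ → ℕ} {ρ : ℕ → Fin 3} {ξ : ℝ}
    (hk : ∀ n, 1 ≤ k (n + 1)) (hstar : ∀ m, ∃ j, 1 < k (m + 2 * j + 1))
    (hρ : ∀ n, IsPrefixSeq (compApply k n [2]) ρ)
    (hc : IsCtsEigenvalue (orbitClosure ρ) (Complex.exp (2 * Real.pi * Complex.I * (ξ : ℂ))))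
    {ε : ℝ} (hε : 0 < ε) (hε' : ε ≤ 1 / 4) :
    ∃ M, ∀ m ≥ M, ∀ j ≤ k (m + 1),
      |j * (ξ * height k (m + 1) - round (ξ * height k (m + 1)))| < ε := by
  obtain ⟨M, hM⟩ := hc.exists_norm_pow_sub_one_lt hρ hstar (ε := 2 * ε) (by positivity)
  refine ⟨M, fun m hm => ?_⟩
  obtain ⟨u, hu⟩ := exists_isProperPrefix_replicate hk hstar m
  set c := Complex.exp (2 * Real.pi * Complex.I * (ξ : ℂ)) with hcdef
  have hc1 : ‖c‖ = 1 := by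
    rw [hcdef, show 2 * Real.pi * Complex.I * (ξ : ℂ) = (2 * Real.pi * ξ : ℝ) * Complex.I by
      push_cast; ring]
    exact Complex.norm_exp_ofReal_mul_I _
  have hnear : ∀ j : ℕ, j ≤ k (m + 1) →
      |j * (ξ * height k (m + 1)) - round (j * (ξ * height k (m + 1)))| < ε := by
    intro j hj
    have h0 := hM m hm _ (hu 0 (Nat.zero_le _))
    have h1 := hM m hm _ (hu j hj)
    rw [compApply_append, List.length_append, length_compApply_replicate] at h0 h1
    simp only [zero_mul, add_zero] at h0
    change ‖c ^ (_ + j * height k (m + 1)) - 1‖ < _ at h1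
    set a := (compApply k m u).length
    have h2 : ‖c ^ (j * height k (m + 1)) - 1‖ < 4 * ε := by
      calc ‖c ^ (j * height k (m + 1)) - 1‖
          = ‖c ^ a * (c ^ (j * height k (m + 1)) - 1)‖ := by
            rw [norm_mul, norm_pow, hc1, one_pow, one_mul]
        _ = ‖(c ^ (a + j * height k (m + 1)) - 1) - (c ^ a - 1)‖ := by
            congr 1
            ring
        _ ≤ _ := norm_sub_le _ _
        _ < 4 * ε := by linarith
    have h3 := four_mul_abs_sub_round_le (j * (ξ * height k (m + 1)))
    have h4 : c ^ (j * height k (m + 1)) =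
        Complex.exp (2 * Real.pi * Complex.I * (j * (ξ * height k (m + 1)) : ℝ)) := by
      rw [hcdef, ← Complex.exp_nat_mul]
      congr 1
      push_cast
      ring
    rw [h4] at h2
    linarith
  have h1 := hnear 1 (hk m)
  simp only [Nat.cast_one, one_mul] at h1
  exact fun j hj => abs_mul_sub_lt_of_forall_near_int hε hε' h1
    (fun j hj => ⟨_, hnear j hj⟩) j hj

theorem IsLengthSeq.not_isCtsEigenvalue {k : ℕ → ℕ} {x : ℕ → ℝ} (hx : IsLengthSeq k x)
    (hirr : Irrational (x 1 - x 2)) {ρ : ℕ → Fin 3}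
    (hρ : ∀ n, IsPrefixSeq (compApply k n [2]) ρ) {ξ : ℝ} (hξ : ξ ∈ Set.Ioo (0 : ℝ) 1) :
    ¬ IsCtsEigenvalue (orbitClosure ρ) (Complex.exp (2 * Real.pi * Complex.I * (ξ : ℂ))) := by
  intro hc
  have key := fun ε hε hε' => exists_abs_mul_height_sub_round_lt (ε := ε) hx.one_le
    hx.exists_one_lt hρ hc hε hε'
  have hg := recAt_height hx.one_le
  have hlim : Tendsto (fun n => ξ * height k n - round (ξ * height k n)) atTop (𝓝 0) := by
    rw [Metric.tendsto_atTop]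
    intro ε hε
    obtain ⟨M, hM⟩ := key (min ε (1 / 4)) (by positivity) (min_le_right _ _)
    refine ⟨M + 1, fun n hn => ?_⟩
    obtain ⟨m, rfl⟩ := Nat.exists_eq_add_of_le' ((Nat.le_add_left 1 M).trans hn)
    have := hM m (by omega) 1 (hx.one_le m)
    rw [Nat.cast_one, one_mul] at this
    rw [Real.dist_eq, sub_zero]
    exact this.trans_le (min_le_left _ _)
  obtain ⟨M, hM⟩ := key (1 / 8) (by norm_num) (by norm_num)
  have hM1 : ∀ n ≥ M, |ξ * height k (n + 1) - round (ξ * height k (n + 1))| < 1 / 8 := by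
    intro n hn
    simpa using hM n hn 1 (hx.one_le n)
  have hrec : ∀ n ≥ M + 1, RecAt k (fun i => round (ξ * height k i)) n := by
    intro n hn
    have h0 := hM1 (n - 1) (by omega)
    rw [Nat.sub_add_cancel (by omega)] at h0
    have h1 := hM n (by omega) _ le_rfl
    have h2 := hM1 (n + 1) (by omega)
    have h3 := hM1 (n + 2) (by omega)
    have hgn := hg n
    unfold RecAt at hgn ⊢
    have hgn' := congrArg (ξ * ·) hgn
    simp only [add_assoc, Nat.reduceAdd] at hgn' h2 h3 ⊢
    rw [abs_lt] at h0 h1 h2 h3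
    generalize round (ξ * (height k (n + 3) : ℝ)) = a at *
    generalize round (ξ * (height k (n + 2) : ℝ)) = b at *
    generalize round (ξ * (height k (n + 1) : ℝ)) = d at *
    generalize round (ξ * (height k n : ℝ)) = e at *
    have h4 : ((a - (b + k (n + 1) * d - e) : ℤ) : ℝ) < 1 := by push_cast; linarith
    have h5 : (-1 : ℝ) < ((a - (b + k (n + 1) * d - e) : ℤ) : ℝ) := by push_cast; linarith
    have h6 : a - (b + k (n + 1) * d - e) < 1 := by exact_mod_cast h4
    have h7 : -1 < a - (b + k (n + 1) * d - e) := by exact_mod_cast h5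
    omega
  obtain ⟨m', hm', hm'eq⟩ := exists_recAt_extension k (M + 1) _ hrec
  have hm'R : ∀ n, RecAt k (fun i => (m' i : ℝ)) n := by
    intro n
    have := congrArg (Int.cast : ℤ → ℝ) (hm' n)
    push_cast at this
    exact this
  have hy := hx.eq_smul (y := fun i => ξ * height k i - m' i)
    (fun n => ((hg n).const_mul ξ).sub (hm'R n)) (hlim.congr' (by
      filter_upwards [eventually_ge_atTop (M + 1)] with n hn
      rw [hm'eq n hn]))
  have g0 : height k 0 = 0 := rfl
  have g1 : height k 1 = 1 := rfl
  have g2 : height k 2 = 1 := by simp [height, compApply, applyChi, chiSub]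
  simp only [g0, g1, g2, Nat.cast_zero, mul_zero, zero_sub, Nat.cast_one, mul_one] at hy
  obtain ⟨hy1, hy2⟩ := hy
  by_cases hs : m' 0 = 0
  · rw [hs] at hy1
    simp only [Int.cast_zero, neg_zero, zero_mul, sub_eq_zero] at hy1
    obtain ⟨h0, h1⟩ := hξ
    rw [hy1] at h0 h1
    have h0' : 0 < m' 1 := by exact_mod_cast h0
    have h1' : m' 1 < 1 := by exact_mod_cast h1
    omega
  · have hs' : (m' 0 : ℝ) ≠ 0 := by exact_mod_cast hs
    refine (irrational_iff_ne_rational _).1 hirr (m' 1 - m' 2) (m' 0) hs ?_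
    rw [eq_div_iff hs']
    push_cast
    linarith

/-- for `(α,β) ∈ Ω_∞` the sequence `k_i = ⌊1/α_{i−1}⌋` satisfies (★),
and the set of `(α,β) ∈ Ω_∞` whose subshift `X_{α,β}` has no continuous eigenvalue
`e^{2πiξ}`, `ξ ∈ (0,1)`, contains a dense `G_δ` subset of `Ω_∞` (in the subspace
topology). -/
theorem statement14 :
    (∀ p ∈ OmegaInf, StarCond (kseq p)) ∧
    ∃ S : Set ↥OmegaInf, IsGδ S ∧ Dense S ∧
      ∀ p : ↥OmegaInf, p ∈ S →
        ∀ ρ : ℕ → Fin 3, (∀ n : ℕ, IsPrefixSeq (compApply (kseq ↑p) n [2]) ρ) →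
          ∀ ξ ∈ Set.Ioo (0 : ℝ) 1,
            ¬ IsCtsEigenvalue (orbitClosure ρ)
                (Complex.exp (2 * Real.pi * Complex.I * (ξ : ℂ))) := by
  refine ⟨fun p hp => starCond_kseq hp, {p | Irrational (p.1.1 - p.1.2)}, isGδ_irrational_sub,
    dense_irrational_sub, fun p hp ρ hρ ξ hξ => ?_⟩
  refine (isLengthSeq_lengthSeq p.2).not_isCtsEigenvalue ?_ hρ hξ
  rwa [lengthSeq_one, lengthSeq_two p.2]
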